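/- arXiv:1002.3221 — 10 statements merged into one kernel-verified Lean document; each statement's English description precedes it below -/
import Mathlib

section
/- For every positive integer n, one has the polynomial identity (X^n − 1)·Φ_n′(X) = Φ_n(X)·(Σ_{k=1}^{n} c_n(k)·X^{k−1}) in ℤ[X], where Φ_n′ denotes the formal derivative of the n-th cyclotomic polynomial. -/
open Polynomial Finset

/-- Ramanujan sum `c_n(k) = ∑_{d ∣ gcd(n,k)} d·μ(n/d)`. -/
noncomputable def ramanujanSum (n k : ℕ) : ℤ :=
  ∑ d ∈ (Nat.gcd n k).divisors, (d : ℤ) * ArithmeticFunction.moebius (n / d)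

theorem X_pow_sub_one_mul_sum_dvd {R : Type*} [CommRing R] {d n : ℕ} (hd : 0 < d) (h : d ∣ n) :
    (X ^ d - 1 : R[X]) * ∑ k ∈ range n with d ∣ k + 1, X ^ k = X ^ (d - 1) * (X ^ n - 1) := by
  obtain ⟨m, rfl⟩ := h
  have key : ∑ k ∈ range (d * m) with d ∣ k + 1, (X : R[X]) ^ k =
      ∑ j ∈ range m, X ^ (d - 1) * (X ^ d) ^ j := by
    symm
    refine sum_nbij (fun j => d * j + (d - 1)) ?_ ?_ ?_ ?_
    · intro j hj
      have hj : j + 1 ≤ m := by simpa using hj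
      have := Nat.mul_le_mul_left d hj
      rw [Nat.mul_add] at this
      simp only [mem_filter, mem_range]
      exact ⟨by lia, j + 1, by rw [Nat.mul_add]; lia⟩
    · intro i _ j _ hij
      simpa [hd.ne'] using hij
    · intro k hk
      simp only [coe_filter, mem_range, Set.mem_ofPred_eq] at hk
      obtain ⟨hk, q, hq⟩ := hk
      obtain _ | j := q
      · lia
      · have : d * (j + 1) ≤ d * m := by lia
        refine ⟨j, by simpa using Nat.le_of_mul_le_mul_left this hd, ?_⟩
        rw [Nat.mul_add] at hq
        change d * j + (d - 1) = k
        lia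
    · intro j _
      rw [← pow_mul, ← pow_add, add_comm]
  rw [key, ← mul_sum, pow_mul X d m, ← geom_sum_mul (X ^ d) m]
  ring

theorem sum_ramanujanSum_mul_X_pow {n : ℕ} (hn : 0 < n) :
    ∑ k ∈ range n, C (ramanujanSum n (k + 1)) * X ^ k =
      ∑ d ∈ n.divisors, C (ArithmeticFunction.moebius (n / d) : ℤ) *
        ((d : ℤ[X]) * ∑ k ∈ range n with d ∣ k + 1, X ^ k) := by
  have hdiv (k : ℕ) : (n.gcd (k + 1)).divisors = {d ∈ n.divisors | d ∣ k + 1} := by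
    ext d
    simp [Nat.dvd_gcd_iff, hn.ne']
  simp only [ramanujanSum, hdiv, map_sum, sum_mul, mul_sum, sum_filter]
  rw [sum_comm]
  refine sum_congr rfl fun d _ => sum_congr rfl fun k _ => ?_
  split_ifs <;> simp
  ring

theorem X_pow_sub_one_ne_zero {R : Type*} [Ring R] [Nontrivial R] {n : ℕ} (hn : 0 < n) :
    (X ^ n - 1 : R[X]) ≠ 0 := by
  simpa using (monic_X_pow_sub_C (1 : R) hn.ne').ne_zero

theorem sum_divisors_derivative_cyclotomic_div {n : ℕ} (hn : 0 < n) (K : Type*) [Field K]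
    [Algebra ℤ[X] K] [IsFractionRing ℤ[X] K] :
    ∑ d ∈ n.divisors, algebraMap ℤ[X] K (derivative (cyclotomic d ℤ)) /
        algebraMap ℤ[X] K (cyclotomic d ℤ) =
      algebraMap ℤ[X] K ((n : ℤ[X]) * X ^ (n - 1)) / algebraMap ℤ[X] K (X ^ n - 1) := by
  have hne (d : ℕ) : algebraMap ℤ[X] K (cyclotomic d ℤ) ≠ 0 := by
    simpa using cyclotomic_ne_zero d ℤ
  have hX : algebraMap ℤ[X] K (X ^ n - 1) ≠ 0 :=
    (map_ne_zero_iff _ (IsFractionRing.injective ℤ[X] K)).2 (X_pow_sub_one_ne_zero hn)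
  have hder : ((n : ℤ[X]) * X ^ (n - 1)) = derivative (X ^ n - 1) := by simp [derivative_X_pow]
  rw [eq_div_iff hX, hder, ← prod_cyclotomic_eq_X_pow_sub_one hn, derivative_prod_finset,
    map_sum, sum_mul]
  refine sum_congr rfl fun d hd => ?_
  rw [← mul_prod_erase _ _ hd, map_mul, map_mul]
  field_simp [hne d]

/-- For every positive integer `n`, `(X^n - 1)·Φ_n'(X) = Φ_n(X)·∑_{k=1}^{n} c_n(k)·X^(k-1)` in `ℤ[X]`. -/
theorem cyclotomic_deriv_ramanujan (n : ℕ) (hn : 0 < n) :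
    (X ^ n - 1) * derivative (cyclotomic n ℤ) =
      cyclotomic n ℤ * ∑ k ∈ Finset.range n, C (ramanujanSum n (k + 1)) * X ^ k := by
  let K := FractionRing ℤ[X]
  apply IsFractionRing.injective ℤ[X] K
  have hne : algebraMap ℤ[X] K (cyclotomic n ℤ) ≠ 0 := by
    simpa using cyclotomic_ne_zero n ℤ
  have hmoebius := ArithmeticFunction.sum_eq_iff_sum_mul_moebius_eq.mp
    (fun m hm => sum_divisors_derivative_cyclotomic_div hm K) n hn
  rw [eq_div_iff hne] at hmoebius
  rw [map_mul, map_mul, ← hmoebius, ← mul_assoc, mul_comm _ (algebraMap ℤ[X] K (cyclotomic n ℤ)),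
    sum_ramanujanSum_mul_X_pow hn, map_sum,
    Nat.sum_divisorsAntidiagonal' (f := fun a b => ((ArithmeticFunction.moebius a : ℤ) : K) *
      (algebraMap ℤ[X] K ((b : ℤ[X]) * X ^ (b - 1)) / algebraMap ℤ[X] K (X ^ b - 1))),
    mul_sum]
  congr 1
  refine sum_congr rfl fun d hd => ?_
  have hdpos : 0 < d := Nat.pos_of_mem_divisors hd
  have hX : algebraMap ℤ[X] K (X ^ d - 1) ≠ 0 :=
    (map_ne_zero_iff _ (IsFractionRing.injective ℤ[X] K)).2 (X_pow_sub_one_ne_zero hdpos)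
  have hgeom := congrArg (algebraMap ℤ[X] K)
    (X_pow_sub_one_mul_sum_dvd (R := ℤ) hdpos (Nat.dvd_of_mem_divisors hd))
  rw [map_mul, map_mul, mul_comm, eq_comm, ← div_eq_iff hX] at hgeom
  have hC : algebraMap ℤ[X] K (C (ArithmeticFunction.moebius (n / d))) =
      (ArithmeticFunction.moebius (n / d) : ℤ) :=
    eq_intCast ((algebraMap ℤ[X] K).comp C) _
  rw [map_mul, map_mul, map_mul, hC, map_natCast, ← hgeom]
  ring
end

section
/- For every integer n > 1 and every real number x with |x| < 1, the series Σ_{k=1}^{∞} c_n(k)·x^k/k converges and Φ_n(x) = exp(−Σ_{k=1}^{∞} c_n(k)·x^k/k). -/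
open Polynomial Finset

/-- The logarithmic series of `1 - x ^ d`, indexed by the exponents of `x`. -/
theorem hasSum_ite_dvd_mul_pow_div {d : ℕ} (hd : 0 < d) {x : ℝ} (hx : |x| < 1) :
    HasSum (fun k : ℕ => if d ∣ k + 1 then (d : ℝ) * (x ^ (k + 1) / (k + 1)) else 0)
      (-Real.log (1 - x ^ d)) := by
  have hxd : |x ^ d| < 1 := by
    rw [abs_pow]
    exact pow_lt_one₀ (abs_nonneg x) hx hd.ne'
  have hsub (j : ℕ) : d * (j + 1) - 1 + 1 = d * (j + 1) :=
    Nat.sub_add_cancel (Nat.mul_pos hd j.succ_pos)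
  have hinj : Function.Injective fun j : ℕ => d * (j + 1) - 1 := by
    intro i j hij
    have h : d * (i + 1) = d * (j + 1) := by
      rw [← hsub i, ← hsub j]
      exact congrArg (· + 1) hij
    simpa [hd.ne'] using h
  refine (hinj.hasSum_iff ?_).mp ?_
  · intro k hk
    refine if_neg fun ⟨j, hj⟩ => hk ?_
    obtain _ | j := j
    · simp at hj
    · exact ⟨j, by simp [← hj]⟩
  · convert Real.hasSum_pow_div_log_of_abs_lt_one hxd using 2 with j
    have hcast : ((d * (j + 1) - 1 : ℕ) : ℝ) + 1 = d * (j + 1) := by exact_mod_cast hsub j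
    have hd' : (d : ℝ) ≠ 0 := by exact_mod_cast hd.ne'
    simp only [Function.comp_apply, hsub, dvd_mul_right, if_true, hcast, ← pow_mul]
    field_simp

theorem ramanujanSum_eq_sum_divisors_ite {n : ℕ} (hn : n ≠ 0) (k : ℕ) :
    ramanujanSum n k =
      ∑ d ∈ n.divisors, if d ∣ k then (d : ℤ) * ArithmeticFunction.moebius (n / d) else 0 := by
  rw [ramanujanSum, ← Finset.sum_filter]
  congr 1
  ext d
  simp [Nat.dvd_gcd_iff, hn]

theorem eval_cyclotomic_ne_zero_of_abs_lt_one {n : ℕ} (hn : 0 < n) {x : ℝ} (hx : |x| < 1) :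
    (cyclotomic n ℝ).eval x ≠ 0 := by
  intro h
  have hdvd := eval_dvd (x := x) (cyclotomic.dvd_X_pow_sub_one n ℝ)
  rw [h, zero_dvd_iff] at hdvd
  have hpow : x ^ n = 1 := by simpa [sub_eq_zero] using hdvd
  have hlt := pow_lt_one₀ (abs_nonneg x) hx hn.ne'
  rw [← abs_pow, hpow, abs_one] at hlt
  exact lt_irrefl _ hlt

theorem log_eval_cyclotomic_of_abs_lt_one {n : ℕ} (hn : 0 < n) {x : ℝ} (hx : |x| < 1) :
    Real.log ((cyclotomic n ℝ).eval x) =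
      ∑ d ∈ n.divisors, (ArithmeticFunction.moebius (n / d) : ℝ) * Real.log (1 - x ^ d) := by
  have hinv := (ArithmeticFunction.sum_eq_iff_sum_mul_moebius_eq
    (f := fun m => Real.log ((cyclotomic m ℝ).eval x))
    (g := fun m => Real.log (1 - x ^ m))).mp ?_ n hn
  · rw [← hinv, Nat.sum_divisorsAntidiagonal' fun a b =>
      (ArithmeticFunction.moebius a : ℝ) * Real.log (1 - x ^ b)]
  · intro m hm
    rw [← Real.log_prod fun d hd =>
      eval_cyclotomic_ne_zero_of_abs_lt_one (Nat.pos_of_mem_divisors hd) hx,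
      ← eval_prod, prod_cyclotomic_eq_X_pow_sub_one hm, ← Real.log_neg_eq_log]
    simp

theorem eval_cyclotomic_pos_of_abs_lt_one {n : ℕ} (hn : 1 < n) {x : ℝ} (hx : |x| < 1) :
    0 < (cyclotomic n ℝ).eval x := by
  obtain rfl | h := eq_or_lt_of_le (Nat.succ_le_of_lt hn)
  · have := (abs_lt.mp hx).1
    simp only [Nat.succ_eq_add_one, Nat.reduceAdd, cyclotomic_two, eval_add, eval_X, eval_one]
    linarith
  · exact cyclotomic_pos h x

/-- For `n > 1` and real `|x| < 1`, the series `∑_{k≥1} c_n(k) x^k / k` converges to some `L`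
and `Φ_n(x) = exp (-L)`. -/
theorem cyclotomic_eq_exp_neg_tsum_ramanujan (n : ℕ) (hn : 1 < n) (x : ℝ) (hx : |x| < 1) :
    ∃ L : ℝ, HasSum (fun k : ℕ => (ramanujanSum n (k + 1) : ℝ) * x ^ (k + 1) / (k + 1)) L ∧
      (cyclotomic n ℝ).eval x = Real.exp (-L) := by
  have hn0 : 0 < n := zero_lt_one.trans hn
  refine ⟨∑ d ∈ n.divisors, (ArithmeticFunction.moebius (n / d) : ℝ) * -Real.log (1 - x ^ d),
    ?_, ?_⟩
  · have hsum := hasSum_sum fun d (hd : d ∈ n.divisors) =>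
      (hasSum_ite_dvd_mul_pow_div (Nat.pos_of_mem_divisors hd) hx).mul_left
        (ArithmeticFunction.moebius (n / d) : ℝ)
    refine (congrArg (HasSum · _) (funext fun k => ?_)).mpr hsum
    rw [ramanujanSum_eq_sum_divisors_ite hn0.ne', Int.cast_sum, mul_div_assoc, Finset.sum_mul]
    refine Finset.sum_congr rfl fun d _ => ?_
    split_ifs
    · push_cast
      ring
    · simp
  · simp_rw [mul_neg, Finset.sum_neg_distrib, neg_neg]
    rw [← log_eval_cyclotomic_of_abs_lt_one hn0 hx,
      Real.exp_log (eval_cyclotomic_pos_of_abs_lt_one hn hx)]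
end

section
/- For every positive integer n, the number of nonzero coefficients of the polynomial R_n(X) equals γ(n); that is, the number of k with 0 ≤ k ≤ n−1 and c_n(k) ≠ 0 equals γ(n). -/
open Polynomial Finset

/-- `R_n(X) = ∑_{k=0}^{n-1} c_n(k) X^k`. -/
noncomputable def R (n : ℕ) : Polynomial ℤ :=
  ∑ k ∈ Finset.range n, C (ramanujanSum n k) * X ^ k


/-- Squarefree kernel (radical) `γ(n) = ∏_{p ∣ n} p`. -/
def gamma (n : ℕ) : ℕ := ∏ p ∈ n.primeFactors, p

/-- The arithmetic function equal to `d` at the divisors `d` of `k`, and to `0` elsewhere. -/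
def idOnDivisors (k : ℕ) : ArithmeticFunction ℤ :=
  ⟨fun d => if d ∣ k then (d : ℤ) else 0, by simp⟩

theorem idOnDivisors_apply (k d : ℕ) :
    idOnDivisors k d = if d ∣ k then (d : ℤ) else 0 := rfl

theorem isMultiplicative_idOnDivisors (k : ℕ) : (idOnDivisors k).IsMultiplicative := by
  refine ⟨by simp [idOnDivisors_apply], fun {a b} hab => ?_⟩
  have hdvd : a * b ∣ k ↔ a ∣ k ∧ b ∣ k :=
    ⟨fun h => ⟨dvd_of_mul_right_dvd h, dvd_of_mul_left_dvd h⟩,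
      fun h => hab.mul_dvd_of_dvd_of_dvd h.1 h.2⟩
  by_cases ha : a ∣ k <;> by_cases hb : b ∣ k <;> simp [idOnDivisors_apply, hdvd, ha, hb]

/-- The Ramanujan sum `n ↦ c_n(k)` as a Dirichlet convolution, for fixed `k`. -/
def ramanujanConvolution (k : ℕ) : ArithmeticFunction ℤ :=
  idOnDivisors k * ArithmeticFunction.moebius

theorem ramanujanConvolution_apply (n k : ℕ) :
    ramanujanConvolution k n =
      ∑ d ∈ n.divisors, (if d ∣ k then (d : ℤ) else 0) * ArithmeticFunction.moebius (n / d) := by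
  rw [ramanujanConvolution, ArithmeticFunction.mul_apply]
  exact Nat.sum_divisorsAntidiagonal
    (fun d e => (if d ∣ k then (d : ℤ) else 0) * ArithmeticFunction.moebius e)

theorem ramanujanSum_eq_convolution {n : ℕ} (hn : n ≠ 0) (k : ℕ) :
    ramanujanSum n k = ramanujanConvolution k n := by
  have hdiv : (Nat.gcd n k).divisors = n.divisors.filter (· ∣ k) := by
    ext d
    simp [Nat.dvd_gcd_iff, hn]
  rw [ramanujanSum, ramanujanConvolution_apply, hdiv, Finset.sum_filter]
  simp only [ite_mul, zero_mul]

theorem isMultiplicative_ramanujanConvolution (k : ℕ) :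
    (ramanujanConvolution k).IsMultiplicative :=
  (isMultiplicative_idOnDivisors k).mul ArithmeticFunction.isMultiplicative_moebius

theorem ramanujanConvolution_prime_pow_succ {p : ℕ} (hp : p.Prime) (a k : ℕ) :
    ramanujanConvolution k (p ^ (a + 1)) =
      (if p ^ (a + 1) ∣ k then (p : ℤ) ^ (a + 1) else 0) -
        (if p ^ a ∣ k then (p : ℤ) ^ a else 0) := by
  rw [ramanujanConvolution_apply, Nat.sum_divisors_prime_pow hp, Finset.sum_range_succ,
    Finset.sum_range_succ, Finset.sum_eq_zero]
  · rw [Nat.div_self (pow_pos hp.pos _), Nat.pow_div (Nat.le_succ a) hp.pos,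
      Nat.succ_sub (le_refl a), Nat.sub_self, zero_add, pow_one,
      ArithmeticFunction.moebius_apply_prime hp, ArithmeticFunction.moebius_apply_one]
    push_cast
    ring
  · intro i hi
    have hi : i < a := Finset.mem_range.mp hi
    rw [Nat.pow_div (by omega) hp.pos,
      ArithmeticFunction.moebius_apply_prime_pow hp (by omega),
      if_neg (show a + 1 - i ≠ 1 by omega), mul_zero]

theorem ramanujanConvolution_prime_pow_succ_ne_zero_iff {p : ℕ} (hp : p.Prime) (a k : ℕ) :
    ramanujanConvolution k (p ^ (a + 1)) ≠ 0 ↔ p ^ a ∣ k := by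
  rw [ramanujanConvolution_prime_pow_succ hp]
  have hpos : (0 : ℤ) < (p : ℤ) ^ a := pow_pos (by exact_mod_cast hp.pos) a
  have hp1 : (1 : ℤ) < p := by exact_mod_cast hp.one_lt
  by_cases h : p ^ a ∣ k
  · rw [if_pos h]
    refine iff_of_true ?_ h
    split_ifs
    · rw [pow_succ]
      nlinarith
    · omega
  · have h' : ¬ p ^ (a + 1) ∣ k := fun H => h ((pow_dvd_pow p (Nat.le_succ a)).trans H)
    simp [h, h']

theorem ramanujanSum_ne_zero_iff {n : ℕ} (hn : n ≠ 0) (k : ℕ) :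
    ramanujanSum n k ≠ 0 ↔ ∏ p ∈ n.primeFactors, p ^ (n.factorization p - 1) ∣ k := by
  rw [ramanujanSum_eq_convolution hn,
    (isMultiplicative_ramanujanConvolution k).multiplicative_factorization _ hn, Finsupp.prod,
    Finset.prod_ne_zero_iff, Nat.support_factorization]
  have hlocal : ∀ p ∈ n.primeFactors,
      (ramanujanConvolution k (p ^ n.factorization p) ≠ 0 ↔
        p ^ (n.factorization p - 1) ∣ k) := fun p hp => by
    have hpp := Nat.prime_of_mem_primeFactors hp
    obtain ⟨a, ha⟩ := Nat.exists_eq_add_one_of_ne_zero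
      (hpp.factorization_pos_of_dvd hn (Nat.dvd_of_mem_primeFactors hp)).ne'
    rw [ha, Nat.add_sub_cancel]
    exact ramanujanConvolution_prime_pow_succ_ne_zero_iff hpp a k
  refine ⟨fun h => Finset.prod_dvd_of_isRelPrime ?_ fun p hp => (hlocal p hp).mp (h p hp),
    fun h p hp => (hlocal p hp).mpr ((Finset.dvd_prod_of_mem _ hp).trans h)⟩
  intro p hp q hq hpq
  exact Nat.coprime_iff_isRelPrime.mp (Nat.Coprime.pow _ _ ((Nat.coprime_primes
    (Nat.prime_of_mem_primeFactors hp) (Nat.prime_of_mem_primeFactors hq)).mpr hpq))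

theorem prod_primeFactors_pow_pred_mul_gamma {n : ℕ} (hn : n ≠ 0) :
    (∏ p ∈ n.primeFactors, p ^ (n.factorization p - 1)) * gamma n = n := by
  rw [gamma, ← Finset.prod_mul_distrib]
  conv_rhs => rw [← Nat.prod_factorization_pow_eq_self hn, Finsupp.prod,
    Nat.support_factorization]
  refine Finset.prod_congr rfl fun p hp => ?_
  rw [pow_sub_one_mul]
  exact ((Nat.prime_of_mem_primeFactors hp).factorization_pos_of_dvd hn
    (Nat.dvd_of_mem_primeFactors hp)).ne'

theorem card_filter_dvd_range_mul {m : ℕ} (hm : 0 < m) (r : ℕ) :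
    ((Finset.range (m * r)).filter (m ∣ ·)).card = r := by
  have himage : (Finset.range (m * r)).filter (m ∣ ·) = (Finset.range r).image (m * ·) := by
    ext k
    simp only [Finset.mem_filter, Finset.mem_range, Finset.mem_image]
    constructor
    · rintro ⟨hk, j, rfl⟩
      exact ⟨j, Nat.lt_of_mul_lt_mul_left hk, rfl⟩
    · rintro ⟨j, hj, rfl⟩
      exact ⟨Nat.mul_lt_mul_of_pos_left hj hm, dvd_mul_right m j⟩
  rw [himage, Finset.card_image_of_injective _ (mul_right_injective₀ hm.ne'),
    Finset.card_range]

/-- The number of nonzero coefficients of `R_n`, i.e. the number of `0 ≤ k ≤ n-1` with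
`c_n(k) ≠ 0`, equals `γ(n)`. -/
theorem card_ramanujanSum_ne_zero (n : ℕ) (hn : 0 < n) :
    ((Finset.range n).filter (fun k => ramanujanSum n k ≠ 0)).card = gamma n := by
  simp only [ramanujanSum_ne_zero_iff hn.ne']
  have hfactor := prod_primeFactors_pow_pred_mul_gamma hn.ne'
  set m := ∏ p ∈ n.primeFactors, p ^ (n.factorization p - 1)
  have hm : 0 < m := Nat.pos_of_ne_zero fun h => hn.ne' (by rw [← hfactor, h, zero_mul])
  calc _ = ((Finset.range (m * gamma n)).filter (m ∣ ·)).card := by rw [hfactor]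
    _ = gamma n := card_filter_dvd_range_mul hm _
end

section
/- For every positive integer n, the degree of the polynomial R_n(X) equals n − n/γ(n). -/
open Polynomial Finset

theorem gamma_eq_radical (n : ℕ) : gamma n = UniqueFactorizationMonoid.radical n := by
  rw [Nat.radical_eq_prod_primeFactors]; rfl

theorem gamma_dvd (n : ℕ) : gamma n ∣ n := Nat.prod_primeFactors_dvd n

theorem squarefree_gamma (n : ℕ) : Squarefree (gamma n) := by
  rw [gamma_eq_radical]
  exact UniqueFactorizationMonoid.squarefree_radical

theorem dvd_gamma_of_squarefree {n e : ℕ} (hn : n ≠ 0) (he : Squarefree e) (hen : e ∣ n) :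
    e ∣ gamma n := by
  rw [← Nat.prod_primeFactors_of_squarefree he]
  exact Finset.prod_dvd_prod_of_subset _ _ _ (Nat.primeFactors_mono hen hn)

theorem div_gamma_dvd_of_moebius_ne_zero {n d : ℕ} (hn : n ≠ 0) (hd : d ∣ n)
    (hμ : ArithmeticFunction.moebius (n / d) ≠ 0) : n / gamma n ∣ d := by
  have h := dvd_gamma_of_squarefree hn (ArithmeticFunction.moebius_ne_zero_iff_squarefree.mp hμ)
    (Nat.div_dvd_of_dvd hd)
  have := Nat.div_dvd_div_left (gamma_dvd n) h
  rwa [Nat.div_div_self hd hn] at this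

theorem ramanujanSum_eq_zero {n k : ℕ} (hn : n ≠ 0) (hk : ¬ n / gamma n ∣ k) :
    ramanujanSum n k = 0 := by
  refine Finset.sum_eq_zero fun d hd => ?_
  have hd' := Nat.dvd_of_mem_divisors hd
  by_contra h
  exact hk ((div_gamma_dvd_of_moebius_ne_zero hn (hd'.trans (Nat.gcd_dvd_left _ _))
    (right_ne_zero_of_mul h)).trans (hd'.trans (Nat.gcd_dvd_right _ _)))

theorem ramanujanSum_sub_div_gamma {n : ℕ} (hn : n ≠ 0) :
    ramanujanSum n (n - n / gamma n) =
      (n / gamma n : ℕ) * ArithmeticFunction.moebius (gamma n) := by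
  have hm : n / gamma n ∣ n := Nat.div_dvd_of_dvd (gamma_dvd n)
  have hgcd : n.gcd (n - n / gamma n) = n / gamma n := by
    rw [Nat.gcd_self_sub_right (Nat.div_le_self _ _), Nat.gcd_eq_right hm]
  have hm0 : n / gamma n ≠ 0 := ne_zero_of_dvd_ne_zero hn hm
  rw [ramanujanSum, hgcd, Finset.sum_eq_single_of_mem _ (Nat.mem_divisors_self _ hm0),
    Nat.div_div_self (gamma_dvd n) hn]
  intro d hd hne
  have hd' := Nat.dvd_of_mem_divisors hd
  by_contra h
  exact hne (Nat.dvd_antisymm hd'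
    (div_gamma_dvd_of_moebius_ne_zero hn (hd'.trans hm) (right_ne_zero_of_mul h)))

theorem coeff_R (n k : ℕ) : (R n).coeff k = if k < n then ramanujanSum n k else 0 := by
  simp [R, Polynomial.finsetSum_coeff, Polynomial.coeff_X_pow]

/-- The degree of `R_n` equals `n - n/γ(n)`. -/
theorem natDegree_R (n : ℕ) (hn : 0 < n) :
    (R n).natDegree = n - n / gamma n := by
  have hm : n / gamma n ∣ n := Nat.div_dvd_of_dvd (gamma_dvd n)
  have hm0 : 0 < n / gamma n := Nat.pos_of_dvd_of_pos hm hn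
  refine Polynomial.natDegree_eq_of_le_of_coeff_ne_zero ?_ ?_
  · refine Polynomial.natDegree_le_iff_coeff_eq_zero.mpr fun k hk => ?_
    rw [coeff_R]
    split_ifs with hkn
    · refine ramanujanSum_eq_zero hn.ne' fun hdvd => ?_
      have := Nat.le_of_dvd (by omega) (Nat.dvd_sub hm hdvd)
      omega
    · rfl
  · rw [coeff_R, if_pos (Nat.sub_lt hn hm0), ramanujanSum_sub_div_gamma hn.ne']
    exact mul_ne_zero (by exact_mod_cast hm0.ne')
      (ArithmeticFunction.moebius_ne_zero_iff_squarefree.mpr (squarefree_gamma n))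
end

section
/- For every even integer n > 2, R_n(−1) = 0; equivalently, the polynomial 1 + X divides R_n(X) in ℤ[X] for every even n > 2. -/
open Polynomial Finset

/-- Summing `f` over the multiples of `d` below `d * m`. -/
theorem sum_range_mul_filter_dvd {M : Type*} [AddCommMonoid M] (d m : ℕ) (hd : 0 < d)
    (f : ℕ → M) :
    ∑ k ∈ (Finset.range (d * m)).filter (d ∣ ·), f k = ∑ j ∈ Finset.range m, f (d * j) := by
  symm
  refine Finset.sum_bij (fun j _ => d * j) ?_ ?_ ?_ fun _ _ => rfl
  · intro j hj
    simpa [hd] using hj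
  · intro a _ b _ h
    exact Nat.eq_of_mul_eq_mul_left hd h
  · intro k hk
    obtain ⟨hk, j, rfl⟩ := Finset.mem_filter.mp hk
    exact ⟨j, by simpa [hd] using hk, rfl⟩

/-- Summing `f` over the multiples of `a` among the divisors of `a * m`. -/
theorem sum_divisors_mul_filter_dvd {M : Type*} [AddCommMonoid M] (a m : ℕ) (ha : 0 < a)
    (f : ℕ → M) :
    ∑ d ∈ (a * m).divisors.filter (a ∣ ·), f d = ∑ e ∈ m.divisors, f (a * e) := by
  symm
  refine Finset.sum_bij (fun e _ => a * e) ?_ ?_ ?_ fun _ _ => rfl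
  · intro e he
    have := Nat.mem_divisors.mp he
    simp [Nat.mul_dvd_mul_left a this.1, ha.ne', this.2]
  · intro x _ y _ h
    exact Nat.eq_of_mul_eq_mul_left ha h
  · intro d hd
    obtain ⟨hd, e, rfl⟩ := Finset.mem_filter.mp hd
    obtain ⟨h, h0⟩ := Nat.mem_divisors.mp hd
    exact ⟨e, Nat.mem_divisors.mpr ⟨Nat.dvd_of_mul_dvd_mul_left ha h, (mul_ne_zero_iff.mp h0).2⟩,
      rfl⟩

theorem sum_divisors_moebius_div_eq_zero (m : ℕ) (hm : 1 < m) :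
    ∑ e ∈ m.divisors, ArithmeticFunction.moebius (m / e) = 0 := by
  rw [Nat.sum_div_divisors m (fun e => ArithmeticFunction.moebius e),
    ← ArithmeticFunction.coe_mul_zeta_apply, ArithmeticFunction.moebius_mul_coe_zeta,
    ArithmeticFunction.one_apply_ne hm.ne']

theorem mul_sum_neg_one_pow_filter_dvd (n d : ℕ) (hn : n ≠ 0) (heven : Even n) (hd : d ∣ n) :
    (d : ℤ) * ∑ k ∈ (Finset.range n).filter (d ∣ ·), (-1 : ℤ) ^ k =
      if 2 ∣ d then (n : ℤ) else 0 := by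
  obtain ⟨m, rfl⟩ := hd
  rw [sum_range_mul_filter_dvd d m (Nat.pos_of_ne_zero (mul_ne_zero_iff.mp hn).1)]
  split_ifs with h
  · simp [pow_mul, (even_iff_two_dvd.mpr h).neg_one_pow]
  · have hodd : Odd d := by rwa [← Nat.not_even_iff_odd, even_iff_two_dvd]
    have hm : Even m := (Nat.even_mul.mp heven).resolve_left (Nat.not_even_iff_odd.mpr hodd)
    simp [pow_mul, hodd.neg_one_pow, neg_one_geom_sum, hm]

theorem ramanujanSum_eq_sum_divisors (n k : ℕ) (hn : n ≠ 0) :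
    ramanujanSum n k =
      ∑ d ∈ n.divisors, if d ∣ k then (d : ℤ) * ArithmeticFunction.moebius (n / d) else 0 := by
  rw [ramanujanSum, ← Finset.sum_filter]
  congr 1
  ext d
  simp [Nat.dvd_gcd_iff, hn]

theorem R_eval_neg_one_eq_sum_divisors (n : ℕ) (hn : n ≠ 0) :
    (R n).eval (-1) = ∑ d ∈ n.divisors, ArithmeticFunction.moebius (n / d) *
      ((d : ℤ) * ∑ k ∈ (Finset.range n).filter (d ∣ ·), (-1 : ℤ) ^ k) := by
  simp only [R, eval_finsetSum, eval_mul, eval_C, eval_pow, eval_X,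
    ramanujanSum_eq_sum_divisors n _ hn, Finset.sum_mul]
  rw [Finset.sum_comm]
  refine Finset.sum_congr rfl fun d _ => ?_
  rw [Finset.sum_filter, Finset.mul_sum, Finset.mul_sum]
  refine Finset.sum_congr rfl fun k _ => ?_
  split_ifs <;> ring

/-- For every even integer `n > 2`, `R_n(-1) = 0`; equivalently `1 + X` divides `R_n` in `ℤ[X]`. -/
theorem R_eval_neg_one_of_even (n : ℕ) (hn : 2 < n) (heven : Even n) :
    (R n).eval (-1) = 0 ∧ (1 + X) ∣ R n := by
  have hn0 : n ≠ 0 := by lia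
  have hroot : (R n).eval (-1) = 0 := by
    rw [R_eval_neg_one_eq_sum_divisors n hn0, Finset.sum_congr rfl fun d hd => by
      rw [mul_sum_neg_one_pow_filter_dvd n d hn0 heven (Nat.dvd_of_mem_divisors hd)]]
    simp only [mul_ite, mul_zero]
    rw [← Finset.sum_filter, ← Finset.sum_mul]
    obtain ⟨m, rfl⟩ := even_iff_two_dvd.mp heven
    rw [sum_divisors_mul_filter_dvd 2 m two_pos]
    simp only [Nat.mul_div_mul_left _ _ two_pos]
    rw [sum_divisors_moebius_div_eq_zero m (by lia), zero_mul]
  refine ⟨hroot, ?_⟩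
  have hdvd := dvd_iff_isRoot.mpr hroot
  rwa [C_neg, C_1, sub_neg_eq_add, add_comm] at hdvd
end

section
/- For every positive integer n, one has the polynomial identity R_n(X) = (n/γ(n))·R_{γ(n)}(X^{n/γ(n)}) in ℤ[X]. -/
open Polynomial Finset

theorem Squarefree.dvd_gamma {n e : ℕ} (hn : n ≠ 0) (he : Squarefree e) (h : e ∣ n) :
    e ∣ gamma n := by
  rw [← Nat.prod_primeFactors_of_squarefree he]
  exact Finset.prod_dvd_prod_of_subset _ _ _ (Nat.primeFactors_mono h hn)

/-- If every squarefree divisor of `m * g` divides `g`, then `d ∣ m * g` and `μ(m * g / d) ≠ 0`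
force `m ∣ d`. -/
theorem dvd_of_moebius_ne_zero {m g d : ℕ} (hg : 0 < g)
    (h : ∀ e, Squarefree e → e ∣ m * g → e ∣ g) (hd : d ∣ m * g)
    (hμ : ArithmeticFunction.moebius (m * g / d) ≠ 0) : m ∣ d := by
  obtain ⟨c, hc⟩ := h _ (ArithmeticFunction.moebius_ne_zero_iff_squarefree.mp hμ)
    (Nat.div_dvd_of_dvd hd)
  have hd' : d * (m * g / d) = m * g := Nat.mul_div_cancel' hd
  have he : 0 < m * g / d := Nat.pos_of_mul_pos_right (hc ▸ hg)
  refine ⟨c, Nat.eq_of_mul_eq_mul_right he ?_⟩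
  rw [hd', mul_assoc, mul_comm c, ← hc]

theorem ramanujanSum_eq_zero_s9 {m g k : ℕ} (hg : 0 < g)
    (h : ∀ e, Squarefree e → e ∣ m * g → e ∣ g) (hk : ¬ m ∣ k) :
    ramanujanSum (m * g) k = 0 := by
  refine Finset.sum_eq_zero fun d hd ↦ ?_
  have hd' := Nat.dvd_of_mem_divisors hd
  by_contra hne
  exact hk ((dvd_of_moebius_ne_zero hg h (hd'.trans (Nat.gcd_dvd_left _ _))
    (right_ne_zero_of_mul hne)).trans (hd'.trans (Nat.gcd_dvd_right _ _)))

theorem ramanujanSum_mul_mul {m g : ℕ} (hm : 0 < m) (hg : 0 < g)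
    (h : ∀ e, Squarefree e → e ∣ m * g → e ∣ g) (j : ℕ) :
    ramanujanSum (m * g) (m * j) = m * ramanujanSum g j := by
  have hgcd : Nat.gcd g j ≠ 0 := (Nat.gcd_pos_of_pos_left j hg).ne'
  unfold ramanujanSum
  rw [Nat.gcd_mul_left, Finset.mul_sum]
  symm
  refine Finset.sum_of_injOn (fun d ↦ m * d) (fun a _ b _ hab ↦ Nat.eq_of_mul_eq_mul_left hm hab)
    (fun d hd ↦ ?_) (fun d hd hd' ↦ ?_) (fun d _ ↦ ?_)
  · exact Nat.mem_divisors.mpr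
      ⟨Nat.mul_dvd_mul_left m (Nat.dvd_of_mem_divisors hd), mul_ne_zero hm.ne' hgcd⟩
  · by_contra hne
    have hdvd := Nat.dvd_of_mem_divisors hd
    obtain ⟨c, rfl⟩ := dvd_of_moebius_ne_zero hg h
      (hdvd.trans (Nat.mul_dvd_mul_left m (Nat.gcd_dvd_left g j))) (right_ne_zero_of_mul hne)
    exact hd' ⟨c, Nat.mem_divisors.mpr ⟨Nat.dvd_of_mul_dvd_mul_left hm hdvd, hgcd⟩, rfl⟩
  · simp only [Nat.mul_div_mul_left _ _ hm]
    push_cast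
    ring

theorem R_mul_eq_comp {m g : ℕ} (hm : 0 < m) (hg : 0 < g)
    (h : ∀ e, Squarefree e → e ∣ m * g → e ∣ g) :
    R (m * g) = C (m : ℤ) * (R g).comp (X ^ m) := by
  unfold R
  rw [Polynomial.sum_comp, Finset.mul_sum]
  symm
  refine Finset.sum_of_injOn (fun j ↦ m * j) (fun a _ b _ hab ↦ Nat.eq_of_mul_eq_mul_left hm hab)
    (fun j hj ↦ ?_) (fun k hk hk' ↦ ?_) (fun j _ ↦ ?_)
  · exact Finset.mem_coe.mpr
      (Finset.mem_range.mpr (Nat.mul_lt_mul_of_pos_left (Finset.mem_range.mp hj) hm))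
  · rw [ramanujanSum_eq_zero_s9 hg h, C_0, zero_mul]
    rintro ⟨j, rfl⟩
    exact hk' ⟨j, Finset.mem_coe.mpr
      (Finset.mem_range.mpr (Nat.lt_of_mul_lt_mul_left (Finset.mem_range.mp hk))), rfl⟩
  · rw [ramanujanSum_mul_mul hm hg h, mul_comp, C_comp, X_pow_comp, ← pow_mul, C_mul, mul_assoc]

/-- `R_n(X) = (n/γ(n))·R_{γ(n)}(X^{n/γ(n)})` in `ℤ[X]`. -/
theorem R_eq_radical_comp (n : ℕ) (hn : 0 < n) :
    R n = C ((n / gamma n : ℕ) : ℤ) * (R (gamma n)).comp (X ^ (n / gamma n)) := by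
  have hg : 0 < gamma n := Nat.pos_of_dvd_of_pos (gamma_dvd n) hn
  have hmg : n / gamma n * gamma n = n := Nat.div_mul_cancel (gamma_dvd n)
  have key := R_mul_eq_comp (Nat.div_pos (Nat.le_of_dvd hn (gamma_dvd n)) hg) hg
    fun e he hdvd ↦ he.dvd_gamma hn.ne' (hmg ▸ hdvd)
  rwa [hmg] at key
end

section
/- Let n be a positive integer and p a prime. If p divides n, then R_{np}(X) = p·R_n(X^p) in ℤ[X]. If p does not divide n, then R_{np}(X) = p·R_n(X^p) − (Σ_{j=0}^{p−1} X^{j·n})·R_n(X) in ℤ[X]. -/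
open Polynomial Finset

theorem ramanujanSum_eq_sum_divisors_filter {n : ℕ} (hn : n ≠ 0) (k : ℕ) :
    ramanujanSum n k =
      ∑ d ∈ n.divisors with d ∣ k, (d : ℤ) * ArithmeticFunction.moebius (n / d) := by
  unfold ramanujanSum
  congr 1
  ext d
  simp [Nat.dvd_gcd_iff, hn]

theorem ramanujanSum_add_mul_self (n k j : ℕ) :
    ramanujanSum n (k + j * n) = ramanujanSum n k := by
  simp [ramanujanSum]

theorem sum_divisors_mul_prime_filter_dvd {n p : ℕ} (hn : n ≠ 0) (hp : p.Prime) (k : ℕ) :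
    ∑ d ∈ (n * p).divisors with d ∣ k ∧ p ∣ d,
        (d : ℤ) * ArithmeticFunction.moebius (n * p / d) =
      if p ∣ k then (p : ℤ) * ramanujanSum n (k / p) else 0 := by
  split_ifs with hk
  · obtain ⟨m, rfl⟩ := hk
    rw [Nat.mul_div_cancel_left _ hp.pos, ramanujanSum_eq_sum_divisors_filter hn, mul_sum]
    symm
    refine sum_bij (fun d _ => p * d) ?_ ?_ ?_ ?_
    · intro d hd
      simp only [mem_filter, Nat.mem_divisors] at hd ⊢
      refine ⟨⟨?_, mul_ne_zero hn hp.ne_zero⟩, Nat.mul_dvd_mul_left p hd.2, dvd_mul_right p d⟩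
      rw [mul_comm n]
      exact Nat.mul_dvd_mul_left p hd.1.1
    · intro a _ b _ h
      exact Nat.eq_of_mul_eq_mul_left hp.pos h
    · intro d hd
      simp only [mem_filter, Nat.mem_divisors] at hd
      obtain ⟨⟨hdn, _⟩, hdk, e, rfl⟩ := hd
      rw [mul_comm n] at hdn
      exact ⟨e, by simp [hn, Nat.dvd_of_mul_dvd_mul_left hp.pos hdn,
        Nat.dvd_of_mul_dvd_mul_left hp.pos hdk], rfl⟩
    · intro d _
      rw [mul_comm n, Nat.mul_div_mul_left _ _ hp.pos]
      push_cast
      ring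
  · refine sum_eq_zero fun d hd => ?_
    simp only [mem_filter] at hd
    exact absurd (hd.2.2.trans hd.2.1) hk

theorem ramanujanSum_mul_prime_eq_add {n p : ℕ} (hn : n ≠ 0) (hp : p.Prime) (k : ℕ) :
    ramanujanSum (n * p) k = (if p ∣ k then (p : ℤ) * ramanujanSum n (k / p) else 0) +
      ∑ d ∈ n.divisors with d ∣ k ∧ ¬ p ∣ d,
        (d : ℤ) * ArithmeticFunction.moebius (n * p / d) := by
  rw [ramanujanSum_eq_sum_divisors_filter (mul_ne_zero hn hp.ne_zero),
    ← sum_filter_add_sum_filter_not _ (p ∣ ·), filter_filter, filter_filter,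
    sum_divisors_mul_prime_filter_dvd hn hp]
  congr 2
  ext d
  simp only [mem_filter, Nat.mem_divisors]
  refine ⟨fun ⟨h, hk, hd⟩ => ⟨⟨?_, hn⟩, hk, hd⟩,
    fun ⟨h, hk, hd⟩ => ⟨⟨h.1.mul_right p, mul_ne_zero hn hp.ne_zero⟩, hk, hd⟩⟩
  exact ((hp.coprime_iff_not_dvd.2 hd).symm).dvd_of_dvd_mul_right h.1

theorem ramanujanSum_mul_prime_of_dvd {n p : ℕ} (hn : n ≠ 0) (hp : p.Prime) (h : p ∣ n)
    (k : ℕ) :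
    ramanujanSum (n * p) k = if p ∣ k then (p : ℤ) * ramanujanSum n (k / p) else 0 := by
  rw [ramanujanSum_mul_prime_eq_add hn hp, add_eq_left]
  refine sum_eq_zero fun d hd => ?_
  simp only [mem_filter, Nat.mem_divisors] at hd
  obtain ⟨⟨⟨e, rfl⟩, _⟩, -, hpd⟩ := hd
  have hd0 : 0 < d := Nat.pos_of_ne_zero (left_ne_zero_of_mul hn)
  obtain ⟨f, rfl⟩ := (hp.dvd_mul.1 h).resolve_left hpd
  rw [mul_assoc, Nat.mul_div_cancel_left _ hd0,
    ArithmeticFunction.moebius_eq_zero_of_not_squarefree, mul_zero]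
  intro hsq
  exact hp.not_isUnit (hsq p ⟨f, by ring⟩)

theorem ramanujanSum_mul_prime_of_not_dvd {n p : ℕ} (hn : n ≠ 0) (hp : p.Prime) (h : ¬ p ∣ n)
    (k : ℕ) :
    ramanujanSum (n * p) k =
      (if p ∣ k then (p : ℤ) * ramanujanSum n (k / p) else 0) - ramanujanSum n k := by
  rw [ramanujanSum_mul_prime_eq_add hn hp, sub_eq_add_neg,
    ramanujanSum_eq_sum_divisors_filter hn k, ← sum_neg_distrib]
  congr 1
  refine sum_congr ?_ fun d hd => ?_
  · ext d
    simp only [mem_filter, Nat.mem_divisors]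
    exact ⟨fun ⟨hd, hk, _⟩ => ⟨hd, hk⟩, fun ⟨hd, hk⟩ => ⟨hd, hk, fun hpd => h (hpd.trans hd.1)⟩⟩
  · simp only [mem_filter, Nat.mem_divisors] at hd
    obtain ⟨⟨⟨e, rfl⟩, _⟩, -⟩ := hd
    have hd0 : 0 < d := Nat.pos_of_ne_zero (left_ne_zero_of_mul hn)
    have hcop : Nat.Coprime e p :=
      (hp.coprime_iff_not_dvd.2 fun he => h (he.mul_left d)).symm
    rw [mul_assoc, Nat.mul_div_cancel_left _ hd0, Nat.mul_div_cancel_left _ hd0,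
      ArithmeticFunction.isMultiplicative_moebius.map_mul_of_coprime hcop,
      ArithmeticFunction.moebius_apply_prime hp]
    ring

theorem sum_range_mul_ite_dvd_eq_comp (n : ℕ) {p : ℕ} (hp : 0 < p) :
    ∑ k ∈ range (n * p),
        C (if p ∣ k then (p : ℤ) * ramanujanSum n (k / p) else 0) * (X : ℤ[X]) ^ k =
      C (p : ℤ) * (R n).comp (X ^ p) := by
  have hcomp : C (p : ℤ) * (R n).comp (X ^ p) =
      ∑ j ∈ range n, C ((p : ℤ) * ramanujanSum n j) * (X : ℤ[X]) ^ (p * j) := by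
    simp only [R, Polynomial.sum_comp, mul_sum, mul_comp, C_comp, X_pow_comp, pow_mul, C_mul,
      mul_assoc]
  rw [hcomp]
  symm
  refine sum_of_injOn (p * ·) ?_ ?_ ?_ ?_
  · intro a _ b _ h
    exact Nat.eq_of_mul_eq_mul_left hp h
  · intro j hj
    simp only [coe_range, Set.mem_Iio] at hj ⊢
    rw [mul_comm n]
    exact Nat.mul_lt_mul_of_pos_left hj hp
  · intro k hk hk'
    rw [if_neg, C_0, zero_mul]
    rintro ⟨j, rfl⟩
    refine hk' ⟨j, ?_, rfl⟩
    rw [mem_range, mul_comm n] at hk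
    simpa using Nat.lt_of_mul_lt_mul_left hk
  · intro j _
    simp [Nat.mul_div_cancel_left _ hp]

theorem sum_range_mul_ramanujanSum (n p : ℕ) :
    ∑ k ∈ range (n * p), C (ramanujanSum n k) * (X : ℤ[X]) ^ k =
      (∑ j ∈ range p, X ^ (j * n)) * R n := by
  induction p with
  | zero => simp
  | succ p ih =>
    rw [Nat.mul_succ, sum_range_add, ih, sum_range_succ, add_mul, R, mul_sum _ _ (X ^ (p * n))]
    congr 1
    refine sum_congr rfl fun k _ => ?_
    rw [mul_comm n, add_comm, ramanujanSum_add_mul_self, pow_add]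
    ring

/-- For a prime `p`: if `p ∣ n` then `R_{np}(X) = p·R_n(X^p)`; if `p ∤ n` then
`R_{np}(X) = p·R_n(X^p) - (∑_{j=0}^{p-1} X^{jn})·R_n(X)`. -/
theorem R_mul_prime (n p : ℕ) (hn : 0 < n) (hp : p.Prime) :
    (p ∣ n → R (n * p) = C (p : ℤ) * (R n).comp (X ^ p)) ∧
    (¬ p ∣ n → R (n * p) =
      C (p : ℤ) * (R n).comp (X ^ p) - (∑ j ∈ Finset.range p, X ^ (j * n)) * R n) := by
  rw [← sum_range_mul_ite_dvd_eq_comp n hp.pos, ← sum_range_mul_ramanujanSum,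
    ← sum_sub_distrib, R]
  refine ⟨fun h => sum_congr rfl fun k _ => ?_, fun h => sum_congr rfl fun k _ => ?_⟩
  · rw [ramanujanSum_mul_prime_of_dvd hn.ne' hp h]
  · rw [ramanujanSum_mul_prime_of_not_dvd hn.ne' hp h, C_sub, sub_mul]
end

section
/- For every odd positive integer n, one has the polynomial identity R_{2n}(X) = (1 − X^n)·R_n(−X) in ℤ[X]. -/
open Polynomial Finset

theorem moebius_two_mul_of_odd {m : ℕ} (hm : Odd m) :
    ArithmeticFunction.moebius (2 * m) = -ArithmeticFunction.moebius m := by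
  rw [ArithmeticFunction.isMultiplicative_moebius.map_mul_of_coprime hm.coprime_two_left,
    ArithmeticFunction.moebius_apply_prime Nat.prime_two, neg_one_mul]

theorem sum_divisors_two_mul_of_odd {M : Type*} [AddCommMonoid M] {g : ℕ} (hg : Odd g)
    (f : ℕ → M) :
    ∑ d ∈ (2 * g).divisors, f d = ∑ d ∈ g.divisors, (f d + f (2 * d)) := by
  rw [Nat.divisors_mul, Finset.mul_def, Finset.sum_image hg.coprime_two_left.mul_injOn_divisors,
    Finset.sum_product, Nat.prime_two.sum_divisors, add_comm, ← Finset.sum_add_distrib]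
  simp only [one_mul]

theorem ramanujanSum_two_mul_of_odd {n : ℕ} (hn : Odd n) (k : ℕ) :
    ramanujanSum (2 * n) k = (-1) ^ k * ramanujanSum n k := by
  have moebius_div {d : ℕ} (hd : d ∈ (n.gcd k).divisors) :
      ArithmeticFunction.moebius (2 * n / d) = -ArithmeticFunction.moebius (n / d) := by
    have hdn : d ∣ n := (Nat.dvd_of_mem_divisors hd).trans (Nat.gcd_dvd_left n k)
    rw [Nat.mul_div_assoc 2 hdn,
      moebius_two_mul_of_odd (hn.of_dvd_nat (Nat.div_dvd_of_dvd hdn))]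
  unfold ramanujanSum
  rw [Finset.mul_sum]
  rcases Nat.even_or_odd k with hk | hk
  · have hgcd : (2 * n).gcd k = 2 * n.gcd k := by
      obtain ⟨j, rfl⟩ := hk.two_dvd
      rw [Nat.gcd_mul_left, hn.coprime_two_left.gcd_mul_left_cancel_right j]
    rw [hgcd, sum_divisors_two_mul_of_odd (hn.of_dvd_nat (Nat.gcd_dvd_left n k))]
    refine Finset.sum_congr rfl fun d hd => ?_
    rw [moebius_div hd, Nat.mul_div_mul_left n d two_pos, hk.neg_one_pow]
    push_cast
    ring
  · rw [hk.coprime_two_left.gcd_mul_left_cancel n]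
    refine Finset.sum_congr rfl fun d hd => ?_
    rw [moebius_div hd, hk.neg_one_pow]
    ring

theorem ramanujanSum_add_self (n k : ℕ) : ramanujanSum n (n + k) = ramanujanSum n k := by
  simp [ramanujanSum]

/-- For every odd positive integer `n`, `R_{2n}(X) = (1 - X^n)·R_n(-X)` in `ℤ[X]`. -/
theorem R_two_mul_of_odd (n : ℕ) (hn : 0 < n) (hodd : Odd n) :
    R (2 * n) = (1 - X ^ n) * (R n).comp (-X) := by
  have hcomp : (R n).comp (-X) =
      ∑ k ∈ Finset.range n, C ((-1) ^ k * ramanujanSum n k) * X ^ k := by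
    simp only [R, Polynomial.sum_comp, mul_comp, C_comp, X_pow_comp]
    refine Finset.sum_congr rfl fun k _ => ?_
    rw [neg_pow]
    simp only [map_mul, map_pow, map_neg, map_one]
    ring
  rw [hcomp, R, two_mul, Finset.sum_range_add, ← two_mul, sub_mul, one_mul, sub_eq_add_neg,
    Finset.mul_sum, ← Finset.sum_neg_distrib]
  congr 1 <;> refine Finset.sum_congr rfl fun k _ => ?_
  · rw [ramanujanSum_two_mul_of_odd hodd]
  · rw [ramanujanSum_two_mul_of_odd hodd, ramanujanSum_add_self, pow_add, hodd.neg_one_pow]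
    simp only [map_mul, map_pow, map_neg, map_one]
    ring
end

section
/- For every positive integer n, one has the identity R_n(X) = φ(n)·(1 − X^n + Σ_{d | n} (μ(d)/φ(d))·Ψ_d(X^{n/d})) in ℚ[X]. -/
open Polynomial Finset

/-- `Ψ_n(X) = ∑_{1 ≤ j ≤ n, gcd(j,n)=1} X^j`. -/
noncomputable def Psi (n : ℕ) : Polynomial ℚ :=
  ∑ j ∈ (Finset.Icc 1 n).filter (fun j => Nat.gcd j n = 1), X ^ j

/-- The Möbius function of a product is the product of the Möbius functions on coprime pairs and
vanishes on all other pairs. -/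
theorem moebius_mul_eq_ite (m e : ℕ) :
    ArithmeticFunction.moebius (m * e) =
      if m.Coprime e then ArithmeticFunction.moebius m * ArithmeticFunction.moebius e else 0 := by
  split_ifs with h
  · exact ArithmeticFunction.isMultiplicative_moebius.map_mul_of_coprime h
  · exact ArithmeticFunction.moebius_eq_zero_of_not_squarefree fun hs =>
      h (Nat.coprime_of_squarefree_mul hs)

/-- The arithmetic function `n ↦ n⁻¹` with rational values. -/
def ArithmeticFunction.natInv : ArithmeticFunction ℚ := ⟨fun n => (n : ℚ)⁻¹, by simp⟩

theorem ArithmeticFunction.natInv_apply (n : ℕ) :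
    ArithmeticFunction.natInv n = (n : ℚ)⁻¹ := rfl

theorem ArithmeticFunction.isMultiplicative_natInv :
    ArithmeticFunction.natInv.IsMultiplicative := by
  refine ⟨by simp [natInv_apply], fun {m n} _ => ?_⟩
  simp only [natInv_apply, Nat.cast_mul, mul_inv]

/-- Summing `μ(e)/e` over the divisors of `g` coprime to `m` gives an Euler product. -/
theorem sum_coprime_divisors_moebius_div {m g : ℕ} (hm : m ≠ 0) (hg : g ≠ 0) :
    ∑ e ∈ g.divisors with m.Coprime e, (ArithmeticFunction.moebius e : ℚ) * (e : ℚ)⁻¹ =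
      ∏ p ∈ g.primeFactors \ m.primeFactors, (1 - (p : ℚ)⁻¹) := by
  set S := g.primeFactors \ m.primeFactors with hS
  have hprime : ∀ p ∈ S, p.Prime := fun p hp =>
    Nat.prime_of_mem_primeFactors (Finset.mem_sdiff.mp hp).1
  have hfac : (∏ p ∈ S, p).primeFactors = S := Nat.primeFactors_prod hprime
  have hsq : Squarefree (∏ p ∈ S, p) := by
    refine Finset.squarefree_prod_of_pairwise_isCoprime (fun p hp q hq hpq => ?_)
      fun p hp => (hprime p hp).squarefree
    exact Nat.coprime_iff_isRelPrime.mp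
      ((Nat.coprime_primes (hprime p hp) (hprime q hq)).mpr hpq)
  have hdvd : ∏ p ∈ S, p ∣ g :=
    (Finset.prod_dvd_prod_of_subset _ _ _ Finset.sdiff_subset).trans (Nat.prod_primeFactors_dvd g)
  have hcop : m.Coprime (∏ p ∈ S, p) := by
    refine Nat.Coprime.prod_right fun p hp => ?_
    refine ((hprime p hp).coprime_iff_not_dvd.mpr fun h => ?_).symm
    exact (Finset.mem_sdiff.mp hp).2 (Nat.mem_primeFactors.mpr ⟨hprime p hp, h, hm⟩)
  have key := ArithmeticFunction.IsMultiplicative.prodPrimeFactors_one_sub_of_squarefree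
    ArithmeticFunction.natInv ArithmeticFunction.isMultiplicative_natInv hsq
  simp only [hfac, ArithmeticFunction.natInv_apply] at key
  rw [key]
  symm
  refine Finset.sum_subset (fun e he => ?_) fun e he hne => ?_
  · have hed := Nat.dvd_of_mem_divisors he
    exact Finset.mem_filter.mpr
      ⟨Nat.mem_divisors.mpr ⟨hed.trans hdvd, hg⟩, hcop.coprime_dvd_right hed⟩
  · rw [ArithmeticFunction.moebius_eq_zero_of_not_squarefree, Int.cast_zero, zero_mul]
    intro hes
    obtain ⟨heg, hme⟩ := Finset.mem_filter.mp he
    refine hne (Nat.mem_divisors.mpr ⟨?_, hsq.ne_zero⟩)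
    rw [← Nat.prod_primeFactors_of_squarefree hes]
    refine Finset.prod_dvd_prod_of_subset _ _ _ fun p hp => Finset.mem_sdiff.mpr ⟨?_, fun hpm => ?_⟩
    · exact Nat.primeFactors_mono (Nat.dvd_of_mem_divisors heg) hg hp
    · exact Finset.disjoint_left.mp hme.disjoint_primeFactors hpm hp

/-- The quotient `φ(mg)/φ(m)` as an Euler product. -/
theorem totient_mul_eq_totient_mul_prod {m g : ℕ} (hm : m ≠ 0) (hg : g ≠ 0) :
    ((m * g).totient : ℚ) =
      m.totient * (g * ∏ p ∈ g.primeFactors \ m.primeFactors, (1 - (p : ℚ)⁻¹)) := by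
  rw [Nat.totient_eq_mul_prod_factors, Nat.totient_eq_mul_prod_factors,
    Nat.primeFactors_mul hm hg, ← Finset.union_sdiff_self_eq_union,
    Finset.prod_union Finset.disjoint_sdiff, Nat.cast_mul]
  ring

/-- Hölder's evaluation of Ramanujan sums, for `n = m * gcd(n,k)`. -/
theorem sum_divisors_mul_moebius {m g : ℕ} (hm : m ≠ 0) (hg : g ≠ 0) :
    ∑ d ∈ g.divisors, (d : ℚ) * (ArithmeticFunction.moebius (m * g / d) : ℚ) =
      (m * g).totient * (ArithmeticFunction.moebius m / m.totient) := by
  have hφ : (m.totient : ℚ) ≠ 0 := by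
    exact_mod_cast (Nat.totient_pos.mpr (Nat.pos_of_ne_zero hm)).ne'
  rw [totient_mul_eq_totient_mul_prod hm hg, ← sum_coprime_divisors_moebius_div hm hg,
    ← Nat.sum_div_divisors g
      (fun d => (d : ℚ) * (ArithmeticFunction.moebius (m * g / d) : ℚ)),
    Finset.sum_filter]
  trans (g : ℚ) * (∑ e ∈ g.divisors, if m.Coprime e then
      (ArithmeticFunction.moebius e : ℚ) * (e : ℚ)⁻¹ else 0) * ArithmeticFunction.moebius m
  · rw [Finset.mul_sum, Finset.sum_mul]
    refine Finset.sum_congr rfl fun e he => ?_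
    obtain ⟨c, rfl⟩ := Nat.dvd_of_mem_divisors he
    have he0 : e ≠ 0 := left_ne_zero_of_mul hg
    have hc0 : c ≠ 0 := right_ne_zero_of_mul hg
    have he0' : (e : ℚ) ≠ 0 := by exact_mod_cast he0
    rw [Nat.mul_div_cancel_left c (Nat.pos_of_ne_zero he0), ← mul_assoc,
      Nat.mul_div_cancel _ (Nat.pos_of_ne_zero hc0), moebius_mul_eq_ite]
    split_ifs
    · push_cast
      field_simp
    · simp
  · field_simp

/-- Hölder's formula for Ramanujan sums. -/
theorem ramanujanSum_eq_totient_mul {n : ℕ} (hn : 0 < n) (k : ℕ) :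
    (ramanujanSum n k : ℚ) = n.totient *
      (ArithmeticFunction.moebius (n / n.gcd k) / (n / n.gcd k).totient) := by
  have hg : 0 < n.gcd k := Nat.gcd_pos_of_pos_left k hn
  have hm : 0 < n / n.gcd k := Nat.div_pos (Nat.gcd_le_left k hn) hg
  have h := sum_divisors_mul_moebius hm.ne' hg.ne'
  rw [Nat.div_mul_cancel (Nat.gcd_dvd_left n k)] at h
  rw [← h, ramanujanSum]
  push_cast
  rfl

/-- `Ψ_d(X^{n/d})` is the sum of `X^k` over the `1 ≤ k ≤ n` with `n / gcd(n,k) = d`. -/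
theorem Psi_comp_X_pow {n d : ℕ} (hn : 0 < n) (hd : d ∣ n) :
    (Psi d).comp (X ^ (n / d)) =
      ∑ k ∈ Finset.Icc 1 n with n / n.gcd k = d, (X : ℚ[X]) ^ k := by
  obtain ⟨c, rfl⟩ := hd
  have hd0 : 0 < d := Nat.pos_of_mul_pos_right hn
  have hc0 : 0 < c := Nat.pos_of_mul_pos_left hn
  rw [Nat.mul_div_cancel_left c hd0, Psi, Polynomial.sum_comp]
  refine Finset.sum_bij (fun j _ => c * j) ?_ ?_ ?_ ?_
  · intro j hj
    simp only [Finset.mem_filter, Finset.mem_Icc] at hj ⊢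
    obtain ⟨⟨h1, h2⟩, h3⟩ := hj
    refine ⟨⟨Nat.mul_pos hc0 h1, ?_⟩, ?_⟩
    · rw [mul_comm d]
      exact Nat.mul_le_mul_left c h2
    · rw [mul_comm d, Nat.gcd_mul_left, Nat.gcd_comm, h3, mul_one, Nat.mul_div_cancel_left d hc0]
  · intro a _ b _ h
    exact Nat.eq_of_mul_eq_mul_left hc0 h
  · intro k hk
    simp only [Finset.mem_filter, Finset.mem_Icc] at hk
    obtain ⟨⟨h1, h2⟩, h3⟩ := hk
    have hgcd : (d * c).gcd k = c := by
      have h4 := Nat.div_mul_cancel (Nat.gcd_dvd_left (d * c) k)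
      rw [h3] at h4
      exact Nat.eq_of_mul_eq_mul_left hd0 h4
    obtain ⟨j, rfl⟩ : c ∣ k := hgcd ▸ Nat.gcd_dvd_right (d * c) k
    refine ⟨j, ?_, rfl⟩
    simp only [Finset.mem_filter, Finset.mem_Icc]
    refine ⟨⟨Nat.pos_of_mul_pos_left h1, ?_⟩, ?_⟩
    · rw [mul_comm d] at h2
      exact Nat.le_of_mul_le_mul_left h2 hc0
    · rw [mul_comm d, Nat.gcd_mul_left, Nat.gcd_comm] at hgcd
      exact Nat.eq_of_mul_eq_mul_left hc0 (hgcd.trans (mul_one c).symm)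
  · intro j _
    simp [pow_mul]

/-- Collecting the sum over `d ∣ n` of the `Ψ_d(X^{n/d})` by exponents. -/
theorem sum_divisors_C_mul_Psi_comp {n : ℕ} (hn : 0 < n) (a : ℕ → ℚ) :
    ∑ d ∈ n.divisors, C (a d) * (Psi d).comp (X ^ (n / d)) =
      ∑ k ∈ Finset.Icc 1 n, C (a (n / n.gcd k)) * X ^ k := by
  symm
  rw [← Finset.sum_fiberwise_of_maps_to (t := n.divisors) (g := fun k => n / n.gcd k)
    fun k _ => Nat.mem_divisors.mpr ⟨Nat.div_dvd_of_dvd (Nat.gcd_dvd_left n k), hn.ne'⟩]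
  refine Finset.sum_congr rfl fun d hd => ?_
  rw [Psi_comp_X_pow hn (Nat.dvd_of_mem_divisors hd), Finset.mul_sum]
  refine Finset.sum_congr rfl fun k hk => ?_
  rw [(Finset.mem_filter.mp hk).2]

/-- `R_n(X) = φ(n)·(1 - X^n + ∑_{d ∣ n} (μ(d)/φ(d))·Ψ_d(X^{n/d}))` in `ℚ[X]`. -/
theorem R_eq_totient_mul_Psi_sum (n : ℕ) (hn : 0 < n) :
    (R n).map (Int.castRingHom ℚ) =
      C ((Nat.totient n : ℚ)) * (1 - X ^ n + ∑ d ∈ n.divisors,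
        C ((ArithmeticFunction.moebius d : ℚ) / (Nat.totient d : ℚ)) *
          (Psi d).comp (X ^ (n / d))) := by
  set a : ℕ → ℚ := fun d => (ArithmeticFunction.moebius d : ℚ) / (Nat.totient d : ℚ) with ha
  have hR : (R n).map (Int.castRingHom ℚ) =
      C (n.totient : ℚ) * ∑ k ∈ Finset.range n, C (a (n / n.gcd k)) * X ^ k := by
    rw [R, Polynomial.map_sum, Finset.mul_sum]
    refine Finset.sum_congr rfl fun k _ => ?_
    rw [Polynomial.map_mul, Polynomial.map_C, Polynomial.map_pow, Polynomial.map_X, eq_intCast,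
      ramanujanSum_eq_totient_mul hn, C_mul, mul_assoc]
  have hshift : ∑ k ∈ Finset.range n, C (a (n / n.gcd k)) * X ^ k + X ^ n =
      1 + ∑ k ∈ Finset.Icc 1 n, C (a (n / n.gcd k)) * X ^ k := by
    have h0 : C (a (n / n.gcd 0)) * X ^ 0 = 1 := by simp [ha, Nat.div_self hn]
    have hlast : C (a (n / n.gcd n)) * X ^ n = X ^ n := by simp [ha, Nat.div_self hn]
    have hsucc := Finset.sum_range_succ (fun k => C (a (n / n.gcd k)) * X ^ k) n
    rw [hlast, Finset.range_eq_Ico, Finset.sum_eq_sum_Ico_succ_bot n.succ_pos, h0] at hsucc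
    rw [← hsucc]
    rfl
  rw [hR, sum_divisors_C_mul_Psi_comp hn a, eq_sub_of_add_eq hshift]
  ring
end

section
/- For every positive integer n and every primitive n-th root of unity η, T_n(η) = n·∏_{p | n} (1 − 2/p), the product taken over the primes p dividing n; consequently, for every even integer n ≥ 2, the cyclotomic polynomial Φ_n(X) divides T_n(X) in ℤ[X]. -/
open Polynomial Finset

/-- `T_n(X) = ∑_{k=0}^{n-1} |c_n(k)| X^k`. -/
noncomputable def T (n : ℕ) : Polynomial ℤ :=
  ∑ k ∈ Finset.range n, C (|ramanujanSum n k|) * X ^ k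

open ArithmeticFunction in
theorem sum_divisors_moebius_mul {R : Type*} [CommRing R] {n : ℕ} (hn : n ≠ 0) (f : ℕ → R) :
    ∑ m ∈ n.divisors, (moebius m : R) * f m =
      ∑ U ∈ n.primeFactors.powerset, (-1) ^ #U * f (∏ p ∈ U, p) := by
  have h : ∑ m ∈ n.divisors, (moebius m : R) * f m =
      ∑ m ∈ n.divisors with Squarefree m, (moebius m : R) * f m := by
    rw [sum_filter]
    refine sum_congr rfl fun m _ ↦ ?_
    split_ifs with hm
    · rfl
    · simp [moebius_eq_zero_of_not_squarefree hm]
  rw [h, Nat.sum_divisors_filter_squarefree hn]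
  have hP : (UniqueFactorizationMonoid.normalizedFactors n).toFinset = n.primeFactors := by
    rw [Nat.factors_eq]; rfl
  rw [hP]
  refine sum_congr rfl fun U hU ↦ ?_
  have hU' : U.val.prod = ∏ p ∈ U, p := prod_val U
  rw [hU', isMultiplicative_moebius.map_prod_of_subset_primeFactors n U (mem_powerset.1 hU),
    prod_congr rfl fun p hp ↦ moebius_apply_prime
      (Nat.prime_of_mem_primeFactors (mem_powerset.1 hU hp))]
  simp

theorem ramanujanSum_gcd (n k : ℕ) : ramanujanSum n (n.gcd k) = ramanujanSum n k := by
  simp [ramanujanSum]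

open ArithmeticFunction in
theorem ramanujanSum_div {n e : ℕ} (hn : n ≠ 0) (he : e ∣ n) :
    (ramanujanSum n (n / e) : ℚ) =
      ∑ m ∈ n.divisors, (moebius m : ℚ) * if e ∣ m then (n : ℚ) / m else 0 := by
  have hd : (n.gcd (n / e)).divisors = {d ∈ n.divisors | d ∣ n / e} := by
    ext d
    simp [Nat.dvd_gcd_iff, hn]
  rw [ramanujanSum, hd, sum_filter, ← Nat.sum_div_divisors]
  simp only [Int.cast_sum, apply_ite (Int.cast : ℤ → ℚ), Int.cast_mul, Int.cast_natCast,
    Int.cast_zero]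
  refine sum_congr rfl fun m hm ↦ ?_
  have hmn := Nat.dvd_of_mem_divisors hm
  have hm0 : m ≠ 0 := ne_zero_of_dvd_ne_zero hn hmn
  have hiff : n / m ∣ n / e ↔ e ∣ m := by
    obtain ⟨a, ha⟩ := hmn
    obtain ⟨b, hb⟩ := he
    have ha0 : a ≠ 0 := by rintro rfl; simp_all
    have he0 : e ≠ 0 := by rintro rfl; simp_all
    have h1 : n / m = a := by rw [ha, Nat.mul_div_cancel_left _ (Nat.pos_of_ne_zero hm0)]
    have h2 : n / e = b := by rw [hb, Nat.mul_div_cancel_left _ (Nat.pos_of_ne_zero he0)]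
    rw [h1, h2]
    have hab : m * a = e * b := ha.symm.trans hb
    constructor
    · rintro ⟨c, rfl⟩
      exact ⟨c, Nat.eq_of_mul_eq_mul_right (Nat.pos_of_ne_zero ha0) (by rw [hab]; ring)⟩
    · rintro ⟨c, rfl⟩
      exact ⟨c, Nat.eq_of_mul_eq_mul_left (Nat.pos_of_ne_zero he0) (by rw [← hab]; ring)⟩
  rw [Nat.div_div_self hmn hn]
  simp only [hiff]
  split_ifs
  · rw [Nat.cast_div_charZero hmn, mul_comm]
  · simp

theorem prod_primes_dvd_prod_iff {S U : Finset ℕ} (hS : ∀ p ∈ S, p.Prime)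
    (hU : ∀ p ∈ U, p.Prime) : ∏ p ∈ S, p ∣ ∏ p ∈ U, p ↔ S ⊆ U := by
  refine ⟨fun h p hp ↦ ?_, fun h ↦ prod_dvd_prod_of_subset _ _ _ h⟩
  obtain ⟨q, hq, hpq⟩ := ((hS p hp).prime.dvd_finsetProd_iff _).1 ((dvd_prod_of_mem _ hp).trans h)
  rwa [(Nat.prime_dvd_prime_iff_eq (hS p hp) (hU q hq)).1 hpq]

theorem ramanujanSum_div_prod_primes {n : ℕ} (hn : n ≠ 0) {S : Finset ℕ}
    (hS : S ⊆ n.primeFactors) :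
    (ramanujanSum n (n / ∏ p ∈ S, p) : ℚ) =
      n * ((∏ p ∈ S, (-1 / p : ℚ)) * ∏ p ∈ n.primeFactors \ S, (1 - 1 / p : ℚ)) := by
  have hP : ∀ p ∈ n.primeFactors, p.Prime := fun p hp ↦ Nat.prime_of_mem_primeFactors hp
  rw [ramanujanSum_div hn ((prod_dvd_prod_of_subset _ _ _ hS).trans n.prod_primeFactors_dvd),
    sum_divisors_moebius_mul hn]
  have h := prod_add (fun p : ℕ ↦ (-1 / p : ℚ)) (fun p ↦ if p ∈ S then 0 else 1) n.primeFactors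
  have hl : ∏ p ∈ n.primeFactors, ((-1 / p : ℚ) + if p ∈ S then 0 else 1) =
      (∏ p ∈ S, (-1 / p : ℚ)) * ∏ p ∈ n.primeFactors \ S, (1 - 1 / p : ℚ) := by
    rw [← prod_sdiff hS, mul_comm]
    congr 1
    · exact prod_congr rfl fun p hp ↦ by simp [hp]
    · refine prod_congr rfl fun p hp ↦ ?_
      rw [if_neg (mem_sdiff.1 hp).2]
      ring
  rw [← hl, h, mul_sum]
  refine sum_congr rfl fun U hU ↦ ?_
  have hU' := mem_powerset.1 hU
  simp only [prod_primes_dvd_prod_iff (fun p hp ↦ hP p (hS hp)) (fun p hp ↦ hP p (hU' hp))]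
  split_ifs with hSU
  · rw [prod_eq_one (s := n.primeFactors \ U) fun p hp ↦
      if_neg fun hpS ↦ (mem_sdiff.1 hp).2 (hSU hpS), prod_div_distrib, prod_const]
    push_cast
    ring
  · obtain ⟨p, hpS, hpU⟩ := not_subset.1 hSU
    rw [prod_eq_zero (f := fun p ↦ if p ∈ S then (0 : ℚ) else 1) (mem_sdiff.2 ⟨hS hpS, hpU⟩)
      (if_pos hpS)]
    ring

open ArithmeticFunction in
theorem sum_moebius_mul_abs_ramanujanSum {n : ℕ} (hn : n ≠ 0) :
    ∑ m ∈ n.divisors, (moebius m : ℚ) * (|ramanujanSum n (n / m)| : ℤ) =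
      n * ∏ p ∈ n.primeFactors, (1 - 2 / p : ℚ) := by
  rw [sum_divisors_moebius_mul hn fun m ↦ ((|ramanujanSum n (n / m)| : ℤ) : ℚ)]
  have h2 : ∏ p ∈ n.primeFactors, (1 - 2 / p : ℚ) =
      ∏ p ∈ n.primeFactors, ((-1 / p : ℚ) + (1 - 1 / p)) :=
    prod_congr rfl fun p _ ↦ by ring
  rw [h2, prod_add, mul_sum]
  refine sum_congr rfl fun S hS ↦ ?_
  have hsplit : ∏ p ∈ S, (-1 / p : ℚ) = (-1) ^ #S * ∏ p ∈ S, (1 / p : ℚ) := by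
    rw [← prod_const, ← prod_mul_distrib]
    exact prod_congr rfl fun p _ ↦ by ring
  have hnonneg : 0 ≤ ∏ p ∈ n.primeFactors \ S, (1 - 1 / p : ℚ) := by
    refine prod_nonneg fun p hp ↦ sub_nonneg.2 ?_
    have h1 : (1 : ℚ) ≤ p := by
      exact_mod_cast (Nat.prime_of_mem_primeFactors (mem_sdiff.1 hp).1).one_le
    exact div_le_one_of_le₀ h1 (by positivity)
  have hnonneg' : 0 ≤ ∏ p ∈ S, (1 / p : ℚ) := prod_nonneg fun p _ ↦ by positivity
  rw [Int.cast_abs, ramanujanSum_div_prod_primes hn (mem_powerset.1 hS), hsplit]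
  simp only [abs_mul, abs_pow, abs_neg, abs_one, one_pow, one_mul, Nat.abs_cast,
    abs_of_nonneg hnonneg, abs_of_nonneg hnonneg']
  ring

theorem IsPrimitiveRoot.sum_pow_multiples {R : Type*} [CommRing R] [IsDomain R] {η : R} {n d : ℕ}
    (hη : IsPrimitiveRoot η n) (hn : n ≠ 0) (hd : d ∣ n) :
    ∑ k ∈ range n with d ∣ k, η ^ k = if d = n then 1 else 0 := by
  obtain ⟨e, rfl⟩ := hd
  have hd0 : d ≠ 0 := left_ne_zero_of_mul hn
  have himage : {k ∈ range (d * e) | d ∣ k} = (range e).image (d * ·) := by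
    ext k
    simp only [mem_filter, mem_range, mem_image]
    constructor
    · rintro ⟨hk, j, rfl⟩
      exact ⟨j, lt_of_mul_lt_mul_left' hk, rfl⟩
    · rintro ⟨j, hj, rfl⟩
      exact ⟨Nat.mul_lt_mul_of_pos_left hj (Nat.pos_of_ne_zero hd0), dvd_mul_right _ _⟩
  rw [himage, sum_image fun a _ b _ hab ↦ Nat.eq_of_mul_eq_mul_left (Nat.pos_of_ne_zero hd0) hab]
  simp only [pow_mul]
  have he0 : e ≠ 0 := right_ne_zero_of_mul hn
  rcases eq_or_ne e 1 with rfl | he1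
  · simp
  · rw [(hη.pow (Nat.pos_of_ne_zero hn) rfl).geom_sum_eq_zero (by lia), if_neg]
    intro h
    exact he1 (Nat.eq_of_mul_eq_mul_left (Nat.pos_of_ne_zero hd0) (by rw [mul_one]; exact h.symm))

theorem IsPrimitiveRoot.sum_gcd_divisors_mul_pow {R : Type*} [CommRing R] [IsDomain R] {η : R}
    {n : ℕ} (hη : IsPrimitiveRoot η n) (hn : n ≠ 0) (a : ℕ → R) :
    ∑ k ∈ range n, (∑ d ∈ (n.gcd k).divisors, a d) * η ^ k = a n := by
  have hd (k : ℕ) : (n.gcd k).divisors = {d ∈ n.divisors | d ∣ k} := by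
    ext d
    simp [Nat.dvd_gcd_iff, hn]
  simp only [hd, sum_filter, sum_mul]
  rw [sum_comm]
  have h : ∀ d ∈ n.divisors, ∑ k ∈ range n, (if d ∣ k then a d else 0) * η ^ k =
      if d = n then a d else 0 := fun d hdn ↦ by
    have := hη.sum_pow_multiples hn (Nat.dvd_of_mem_divisors hdn)
    rw [sum_filter] at this
    rw [← mul_boole, ← this, mul_sum]
    refine sum_congr rfl fun k _ ↦ ?_
    split_ifs <;> simp
  rw [sum_congr rfl h]
  simp [hn]

open ArithmeticFunction in
theorem aeval_T_eq_sum_moebius {R : Type*} [CommRing R] [IsDomain R] {η : R} {n : ℕ}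
    (hη : IsPrimitiveRoot η n) (hn : n ≠ 0) :
    aeval η (T n) =
      ((∑ m ∈ n.divisors, moebius m * |ramanujanSum n (n / m)| : ℤ) : R) := by
  let a (k : ℕ) : ℤ := ∑ m ∈ k.divisors, moebius m * |ramanujanSum n (k / m)|
  have ha : ∀ g > 0, ∑ d ∈ g.divisors, a d = |ramanujanSum n g| :=
    sum_eq_iff_sum_mul_moebius_eq.2 fun g _ ↦
      Nat.sum_divisorsAntidiagonal fun x y ↦ moebius x * |ramanujanSum n y|
  rw [← hη.sum_gcd_divisors_mul_pow hn fun d ↦ (a d : R), T, map_sum]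
  refine sum_congr rfl fun k _ ↦ ?_
  rw [← Int.cast_sum, ha _ (Nat.gcd_pos_of_pos_left k (Nat.pos_of_ne_zero hn)), ramanujanSum_gcd]
  simp

/-- `T_n(η) = n·∏_{p ∣ n} (1 - 2/p)` for every primitive `n`-th root of unity `η`;
consequently, for every even `n ≥ 2`, `Φ_n(X)` divides `T_n(X)` in `ℤ[X]`. -/
theorem T_eval_primitive_root (n : ℕ) (hn : 0 < n) :
    (∀ η : ℂ, IsPrimitiveRoot η n →
      Polynomial.aeval η (T n) = (n : ℂ) * ∏ p ∈ n.primeFactors, (1 - 2 / (p : ℂ))) ∧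
    (Even n → cyclotomic n ℤ ∣ T n) := by
  have heval : ∀ η : ℂ, IsPrimitiveRoot η n →
      aeval η (T n) = (n : ℂ) * ∏ p ∈ n.primeFactors, (1 - 2 / (p : ℂ)) := fun η hη ↦ by
    rw [aeval_T_eq_sum_moebius hη hn.ne']
    have h := congrArg (Rat.cast : ℚ → ℂ) (sum_moebius_mul_abs_ramanujanSum hn.ne')
    rw [← Rat.cast_intCast, Int.cast_sum]
    simpa only [Int.cast_mul, Rat.cast_mul, Rat.cast_natCast, Rat.cast_prod, Rat.cast_sub,
      Rat.cast_one, Rat.cast_div, Rat.cast_ofNat] using h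
  refine ⟨heval, fun hev ↦ ?_⟩
  have hη := Complex.isPrimitiveRoot_exp n hn.ne'
  rw [cyclotomic_eq_minpoly hη hn]
  refine minpoly.isIntegrallyClosed_dvd (hη.isIntegral hn) ?_
  rw [heval _ hη, prod_eq_zero (i := 2), mul_zero]
  · exact Nat.mem_primeFactors.2 ⟨Nat.prime_two, hev.two_dvd, hn.ne'⟩
  · norm_num
end
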